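/- Let A = (a_i)_{i≥1} be a strictly increasing sequence of positive integers with a_1 = 1, a_2 = 2, a_3 = 3, a_4 = 4, a_5 = 5, and let k > 5 be an integer. Then for every integer n > 432·k²·(k−1)!·a_k^{k+3}·e^{1/a_k}, one has p_A(n,k)² > (1 + 1/n²)·p_A(n+1,k)·p_A(n−1,k); in particular p_A(n,k)² > p_A(n+1,k)·p_A(n−1,k) for all such n. -/

import Mathlib

/-- The restricted partition function `p_A(n,k)` for the sequence `a` (0-indexed, so the
paper's `a_i` is `a (i-1)`): the number of `k`-tuples `(c_0,…,c_{k-1})` of nonnegative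
integers with `c_0·a_0 + ⋯ + c_{k-1}·a_{k-1} = n`.
It equals `0` for `n < 0` and `1` for `n = 0`. -/
noncomputable def pA (a : ℕ → ℕ) (k : ℕ) (n : ℤ) : ℕ :=
  Set.ncard {c : Fin k → ℕ | (∑ i, (c i : ℤ) * (a i.val : ℤ)) = n}

theorem pA_finite (a : ℕ → ℕ) (ha : ∀ i, 0 < a i) (k : ℕ) (n : ℤ) :
    {c : Fin k → ℕ | (∑ i, (c i : ℤ) * (a i.val : ℤ)) = n}.Finite := by
  refine (Set.finite_Icc (0 : Fin k → ℕ) (fun _ => n.toNat)).subset fun c hc => ⟨zero_le, ?_⟩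
  intro i
  have hle : (c i : ℤ) * (a i.val : ℤ) ≤ n := by
    rw [← show (∑ i, (c i : ℤ) * (a i.val : ℤ)) = n from hc]
    exact Finset.single_le_sum (f := fun i : Fin k => (c i : ℤ) * (a i.val : ℤ))
      (fun j _ => by positivity) (Finset.mem_univ i)
  have hai : (1 : ℤ) ≤ a i.val := by exact_mod_cast ha i.val
  have hci : (0 : ℤ) ≤ c i := by positivity
  have : (c i : ℤ) ≤ n := by nlinarith
  change c i ≤ n.toNat
  omega

theorem pA_of_neg (a : ℕ → ℕ) (k : ℕ) {n : ℤ} (hn : n < 0) : pA a k n = 0 := by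
  unfold pA
  have : {c : Fin k → ℕ | (∑ i, (c i : ℤ) * (a i.val : ℤ)) = n} = ∅ := by
    ext c
    simp only [Set.mem_ofPred_eq, Set.mem_empty_iff_false, iff_false]
    have : 0 ≤ ∑ i, (c i : ℤ) * (a i.val : ℤ) := Finset.sum_nonneg fun i _ => by positivity
    omega
  rw [this, Set.ncard_empty]

theorem pA_zero_parts (a : ℕ → ℕ) (n : ℤ) : pA a 0 n = if n = 0 then 1 else 0 := by
  unfold pA
  split_ifs with h
  · subst h
    have : {c : Fin 0 → ℕ | (∑ i, (c i : ℤ) * (a i.val : ℤ)) = 0} = {0} := by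
      ext c
      simp [Subsingleton.elim c 0]
    rw [this, Set.ncard_singleton]
  · have : {c : Fin 0 → ℕ | (∑ i, (c i : ℤ) * (a i.val : ℤ)) = n} = ∅ := by
      ext c
      simp [Ne.symm h]
    rw [this, Set.ncard_empty]

theorem pA_succ (a : ℕ → ℕ) (ha : ∀ i, 0 < a i) (k : ℕ) (n : ℤ) :
    pA a (k + 1) n = pA a k n + pA a (k + 1) (n - a k) := by
  have hinj₁ : Function.Injective (fun c : Fin k → ℕ => (Fin.snoc c 0 : Fin (k + 1) → ℕ)) := by
    intro c c' h
    have := congrArg Fin.init h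
    simpa using this
  have hinj₂ : Function.Injective
      (fun c : Fin (k + 1) → ℕ => c + Pi.single (Fin.last k) 1) := add_left_injective _
  unfold pA
  rw [← Set.ncard_image_of_injective _ hinj₁,
    ← Set.ncard_image_of_injective
      {c : Fin (k + 1) → ℕ | (∑ i, (c i : ℤ) * (a i.val : ℤ)) = n - a k} hinj₂,
    ← Set.ncard_union_eq _ ((pA_finite a ha _ _).image _) ((pA_finite a ha _ _).image _)]
  · congr 1
    ext c
    simp only [Set.mem_ofPred_eq, Set.mem_union, Set.mem_image]
    constructor
    · intro hc
      rw [Fin.sum_univ_castSucc] at hc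
      rcases Nat.eq_zero_or_pos (c (Fin.last k)) with h0 | h0
      · left
        refine ⟨Fin.init c, ?_, ?_⟩
        · simpa [h0, Fin.init] using hc
        · rw [← h0]
          exact Fin.snoc_init_self c
      · right
        refine ⟨c - Pi.single (Fin.last k) 1, ?_, ?_⟩
        · rw [Fin.sum_univ_castSucc]
          simp [Fin.castSucc_ne_last] at hc ⊢
          rw [Nat.cast_sub h0]
          push_cast
          linarith
        · ext i
          rcases eq_or_ne i (Fin.last k) with rfl | hi
          · simp
            omega
          · simp [hi]
    · rintro (⟨c', hc', rfl⟩ | ⟨c', hc', rfl⟩)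
      · rw [Fin.sum_univ_castSucc]
        simpa using hc'
      · rw [Fin.sum_univ_castSucc] at hc' ⊢
        simp [Fin.castSucc_ne_last] at hc' ⊢
        linarith
  · rw [Set.disjoint_left]
    rintro _ ⟨c, -, rfl⟩ ⟨c', -, h⟩
    have := congrFun h (Fin.last k)
    simp at this

open PowerSeries in
theorem coeff_mul_one_sub_X_pow (g : PowerSeries ℝ) (b m : ℕ) :
    coeff m (g * (1 - X ^ b)) = coeff m g - if b ≤ m then coeff (m - b) g else 0 := by
  rw [mul_sub, mul_one, map_sub, coeff_mul_X_pow']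

open PowerSeries in
theorem mk_pA_mul_prod (a : ℕ → ℕ) (ha : ∀ i, 0 < a i) (k : ℕ) :
    (PowerSeries.mk fun n : ℕ => (pA a k n : ℝ)) * ∏ i ∈ Finset.range k, (1 - X ^ a i) = 1 := by
  induction k with
  | zero =>
    ext n
    simp [pA_zero_parts, coeff_one]
  | succ k ih =>
    rw [Finset.prod_range_succ, mul_comm (∏ i ∈ Finset.range k, _), ← mul_assoc]
    convert ih using 2
    ext n
    rw [coeff_mul_one_sub_X_pow, coeff_mk, coeff_mk, pA_succ a ha]
    split_ifs with h
    · rw [coeff_mk, Nat.cast_sub h]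
      push_cast
      ring
    · rw [pA_of_neg a (k + 1) (n := (n : ℤ) - a k) (by omega)]
      simp

theorem pow_succ_add_le_add_pow {x b : ℝ} (hx : 0 ≤ x) (hb : 0 ≤ b) (j : ℕ) :
    x ^ (j + 1) + (j + 1) * b * x ^ j ≤ (x + b) ^ (j + 1) := by
  induction j with
  | zero => simp
  | succ j ih =>
    have h := mul_le_mul_of_nonneg_right ih (add_nonneg hx hb)
    have h' : 0 ≤ (j + 1 : ℝ) * b * x ^ j * b := by positivity
    rw [pow_succ (x + b)]
    refine le_trans ?_ h
    push_cast
    have e : x ^ (j + 1) = x ^ j * x := pow_succ x j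
    have e' : x ^ (j + 1 + 1) = x ^ j * x * x := by ring
    rw [e', e]
    linarith

theorem pow_succ_sub_le_sub_pow {x b : ℝ} (hb : 0 ≤ b) (hx : b ≤ x) (j : ℕ) :
    x ^ (j + 1) - (j + 1) * b * x ^ j ≤ (x - b) ^ (j + 1) := by
  induction j with
  | zero => simp
  | succ j ih =>
    have h := mul_le_mul_of_nonneg_right ih (sub_nonneg.2 hx)
    have hx0 : 0 ≤ x := hb.trans hx
    have h' : 0 ≤ (j + 1 : ℝ) * b * x ^ j * b := by positivity
    rw [pow_succ (x - b)]
    refine le_trans ?_ h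
    push_cast
    have e : x ^ (j + 1) = x ^ j * x := pow_succ x j
    have e' : x ^ (j + 1 + 1) = x ^ j * x * x := by ring
    rw [e', e]
    linarith

open PowerSeries in
theorem coeff_le_of_mul_one_sub_X_pow {g : PowerSeries ℝ} {b j : ℕ} (hb : 0 < b) {C s : ℝ}
    (hC : 0 ≤ C) (hs : 0 ≤ s)
    (hf : ∀ m, coeff m (g * (1 - X ^ b)) ≤ C * (m + s) ^ j / j.factorial) (m : ℕ) :
    coeff m g ≤ C / b * (m + (s + b)) ^ (j + 1) / (j + 1).factorial := by
  have hb' : (0 : ℝ) < b := by exact_mod_cast hb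
  induction m using Nat.strong_induction_on with
  | _ m ih =>
    have hfm := hf m
    rw [coeff_mul_one_sub_X_pow] at hfm
    have hx : (0 : ℝ) ≤ m + s := by positivity
    have key : C * (m + s) ^ j / j.factorial
        + C / b * (m + s) ^ (j + 1) / (j + 1).factorial
        ≤ C / b * (m + (s + b)) ^ (j + 1) / (j + 1).factorial := by
      have h := pow_succ_add_le_add_pow hx hb'.le j
      have e : C * (m + s) ^ j / j.factorial
          + C / b * (m + s) ^ (j + 1) / (j + 1).factorial
          = C / b / (j + 1).factorial *
            ((m + s) ^ (j + 1) + (j + 1) * b * (m + s) ^ j) := by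
        rw [Nat.factorial_succ]
        push_cast
        field_simp
        ring
      rw [e, ← add_assoc, mul_div_right_comm]
      gcongr
    split_ifs at hfm with h
    · have := ih (m - b) (by omega)
      rw [Nat.cast_sub h, show (m : ℝ) - b + (s + b) = m + s by ring] at this
      linarith
    · have : 0 ≤ C / b * (m + s) ^ (j + 1) / (j + 1).factorial := by positivity
      linarith

open PowerSeries in
theorem le_coeff_of_mul_one_sub_X_pow {g : PowerSeries ℝ} {b j : ℕ} (hb : 0 < b) {C s : ℝ}
    (hC : 0 ≤ C) (hs : 0 ≤ s)
    (hf : ∀ m : ℕ, C * (max (m - s) 0) ^ j / j.factorial ≤ coeff m (g * (1 - X ^ b))) (m : ℕ) :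
    C / b * (max (m - s) 0) ^ (j + 1) / (j + 1).factorial ≤ coeff m g := by
  have hb' : (0 : ℝ) < b := by exact_mod_cast hb
  induction m using Nat.strong_induction_on with
  | _ m ih =>
    have hfm := hf m
    rw [coeff_mul_one_sub_X_pow] at hfm
    set x : ℝ := max (m - s) 0 with hxdef
    have hx : 0 ≤ x := le_max_right _ _
    have key : ∀ y : ℝ, x ^ (j + 1) - (j + 1) * b * x ^ j ≤ y →
        C / b * x ^ (j + 1) / (j + 1).factorial
          ≤ C * x ^ j / j.factorial + C / b * y / (j + 1).factorial := by
      intro y hy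
      have e : C * x ^ j / j.factorial + C / b * y / (j + 1).factorial
          = C / b / (j + 1).factorial * (y + (j + 1) * b * x ^ j) := by
        rw [Nat.factorial_succ]
        push_cast
        field_simp
        ring
      rw [e, mul_div_right_comm]
      gcongr
      linarith
    have small : x ≤ b → x ^ (j + 1) - (j + 1) * b * x ^ j ≤ 0 := by
      intro hxb
      have h1 : x ^ (j + 1) ≤ b * x ^ j := by
        rw [pow_succ, mul_comm]
        gcongr
      have h2 : 0 ≤ (j : ℝ) * (b * x ^ j) := by positivity
      linarith
    split_ifs at hfm with h
    · have hi := ih (m - b) (by omega)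
      rw [Nat.cast_sub h] at hi
      set y : ℝ := max ((m : ℝ) - b - s) 0 with hydef
      have hy : 0 ≤ y := le_max_right _ _
      have := key (y ^ (j + 1)) (by
        rcases le_total x b with hxb | hxb
        · exact (small hxb).trans (by positivity)
        · refine (pow_succ_sub_le_sub_pow hb'.le hxb j).trans ?_
          have hxm : x = m - s := by
            rcases max_choice ((m : ℝ) - s) 0 with h' | h'
            · exact h'
            · rw [← hxdef] at h'
              linarith
          refine pow_le_pow_left₀ (by linarith) ?_ _
          refine le_trans ?_ (le_max_left _ _)
          linarith)
      linarith
    · have hmb : (m : ℝ) ≤ b := by exact_mod_cast (not_le.1 h).le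
      have := key 0 (small (max_le (by linarith) hb'.le))
      simp only [mul_zero, zero_div, add_zero] at this
      linarith

open PowerSeries in
theorem coeff_le_of_mul_prod (a : ℕ → ℕ) (ha : ∀ i, 0 < a i) {j : ℕ} {C s : ℝ} (hC : 0 ≤ C)
    (hs : 0 ≤ s) (t : Finset ℕ) (g : PowerSeries ℝ)
    (hf : ∀ m, coeff m (g * ∏ i ∈ t, (1 - X ^ a i)) ≤ C * (m + s) ^ j / j.factorial) (m : ℕ) :
    coeff m g ≤ C / (∏ i ∈ t, (a i : ℝ)) * (m + (s + ∑ i ∈ t, (a i : ℝ))) ^ (j + t.card)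
      / (j + t.card).factorial := by
  induction t using Finset.induction_on generalizing g m with
  | empty => simpa using hf m
  | insert i t hi ih =>
    rw [Finset.prod_insert hi, ← mul_assoc] at hf
    have := coeff_le_of_mul_one_sub_X_pow (ha i) (by positivity) (by positivity) (ih _ hf) m
    rw [Finset.prod_insert hi, Finset.sum_insert hi, Finset.card_insert_of_notMem hi]
    convert this using 2
    · rw [div_div, mul_comm (a i : ℝ), ← add_assoc j, add_comm (a i : ℝ), ← add_assoc s]
    · rw [add_assoc]

open PowerSeries in
theorem le_coeff_of_mul_prod (a : ℕ → ℕ) (ha : ∀ i, 0 < a i) {j : ℕ} {C s : ℝ} (hC : 0 ≤ C)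
    (hs : 0 ≤ s) (t : Finset ℕ) (g : PowerSeries ℝ)
    (hf : ∀ m : ℕ, C * (max (m - s) 0) ^ j / j.factorial
      ≤ coeff m (g * ∏ i ∈ t, (1 - X ^ a i))) (m : ℕ) :
    C / (∏ i ∈ t, (a i : ℝ)) * (max (m - s) 0) ^ (j + t.card) / (j + t.card).factorial
      ≤ coeff m g := by
  induction t using Finset.induction_on generalizing g m with
  | empty => simpa using hf m
  | insert i t hi ih =>
    rw [Finset.prod_insert hi, ← mul_assoc] at hf
    have := le_coeff_of_mul_one_sub_X_pow (ha i) (by positivity) hs (ih _ hf) m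
    rw [Finset.prod_insert hi, Finset.card_insert_of_notMem hi]
    convert this using 2
    · rw [div_div, mul_comm (a i : ℝ), ← add_assoc j]
    · rw [add_assoc]

open PowerSeries in
theorem le_coeff_of_mul_two_three {f : PowerSeries ℝ} (hf : f * ((1 - X ^ 2) * (1 - X ^ 3)) = 1)
    (m : ℕ) : 1 / 6 * (max ((m : ℝ) - 6) 0) ^ 1 / (Nat.factorial 1) ≤ coeff m f := by
  have recurrence (m : ℕ) : coeff m f - (if 2 ≤ m then coeff (m - 2) f else 0)
      - (if 3 ≤ m then coeff (m - 3) f else 0) + (if 5 ≤ m then coeff (m - 5) f else 0)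
      = if m = 0 then 1 else 0 := by
    have h := congrArg (coeff m) hf
    rw [show f * ((1 - X ^ 2) * (1 - X ^ 3)) = f - f * X ^ 2 - f * X ^ 3 + f * X ^ 5 by ring,
      map_add, map_sub, map_sub, coeff_mul_X_pow', coeff_mul_X_pow', coeff_mul_X_pow',
      coeff_one] at h
    exact h
  have v0 := recurrence 0
  have v1 := recurrence 1
  have v2 := recurrence 2
  have v3 := recurrence 3
  have v4 := recurrence 4
  have v5 := recurrence 5
  have v6 := recurrence 6
  have v7 := recurrence 7
  have v8 := recurrence 8
  have v9 := recurrence 9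
  have v10 := recurrence 10
  norm_num at v0 v1 v2 v3 v4 v5 v6 v7 v8 v9 v10
  have per (m : ℕ) : coeff (m + 6) f = coeff m f + 1 := by
    induction m using Nat.strong_induction_on with
    | _ m ih =>
      rcases lt_or_ge m 5 with h | h
      · interval_cases m <;> norm_num <;> linarith
      · obtain ⟨l, rfl⟩ := Nat.exists_eq_add_of_le' h
        have r := recurrence (l + 5)
        have r' := recurrence (l + 11)
        simp at r r'
        have i0 := ih l (by omega)
        have i2 := ih (l + 2) (by omega)
        have i3 := ih (l + 3) (by omega)
        simp only [add_assoc, Nat.reduceAdd] at *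
        linarith
  induction m using Nat.strong_induction_on with
  | _ m ih =>
    rcases lt_or_ge m 6 with h | h
    · rw [max_eq_right (by have : (m : ℝ) < 6 := by exact_mod_cast h
                           linarith)]
      interval_cases m <;> norm_num <;> linarith
    · obtain ⟨l, rfl⟩ := Nat.exists_eq_add_of_le' h
      rw [per]
      have := ih l (by omega)
      rw [max_eq_left (by push_cast; linarith [Nat.cast_nonneg (α := ℝ) l])]
      have h' := le_max_left ((l : ℝ) - 6) 0
      simp at this ⊢
      linarith

open PowerSeries in
theorem coeff_le_of_mul_alternating_three_five {f : PowerSeries ℝ}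
    (hf : f * ((1 + X) * ((1 - X ^ 3) * (1 - X ^ 5))) = 1) (m : ℕ) :
    coeff m f ≤ 1 / 30 * ((m : ℝ) + 40) ^ 1 / (Nat.factorial 1) := by
  obtain ⟨H, hH⟩ : ∃ H, H = f * (1 - X ^ 15) := ⟨_, rfl⟩
  have hHΦ : H * (1 - X ^ 2) = 1 - X + X ^ 3 - X ^ 4 + X ^ 5 - X ^ 7 + X ^ 8 := by
    rw [hH]
    linear_combination (1 - X + X ^ 3 - X ^ 4 + X ^ 5 - X ^ 7 + X ^ 8 : PowerSeries ℝ) * hf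
  have recurrence (m : ℕ) : coeff m H - (if 2 ≤ m then coeff (m - 2) H else 0)
      = (if m = 0 then 1 else 0) - (if m = 1 then 1 else 0) + (if m = 3 then 1 else 0)
        - (if m = 4 then 1 else 0) + (if m = 5 then 1 else 0) - (if m = 7 then 1 else 0)
        + (if m = 8 then 1 else 0) := by
    rw [← coeff_mul_one_sub_X_pow, hHΦ]
    simp only [map_add, map_sub, coeff_one, coeff_X, coeff_X_pow]
  have tail (i : ℕ) : coeff (2 * i + 7) H = 0 ∧ coeff (2 * i + 8) H = 1 := by
    induction i with
    | zero =>
      have v0 := recurrence 0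
      have v1 := recurrence 1
      have v2 := recurrence 2
      have v3 := recurrence 3
      have v4 := recurrence 4
      have v5 := recurrence 5
      have v6 := recurrence 6
      have v7 := recurrence 7
      have v8 := recurrence 8
      norm_num at v0 v1 v2 v3 v4 v5 v6 v7 v8 ⊢
      constructor <;> linarith
    | succ i ih =>
      have r := recurrence (2 * i + 9)
      have r' := recurrence (2 * i + 10)
      simp at r r'
      rw [show 2 * (i + 1) + 7 = 2 * i + 9 by ring, show 2 * (i + 1) + 8 = 2 * i + 10 by ring]
      constructor <;> linarith [ih.1, ih.2]
  have step (m : ℕ) : coeff m f = coeff m H + if 15 ≤ m then coeff (m - 15) f else 0 := by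
    rw [hH, coeff_mul_one_sub_X_pow]
    ring
  have bound (m : ℕ) :
      coeff m f ≤ 1 / 30 * ((m : ℝ) + 25) + if m % 2 = 0 then 1 / 2 else 0 := by
    induction m using Nat.strong_induction_on with
    | _ m ih =>
      rcases lt_or_ge m 15 with h | h
      · have v0 := recurrence 0
        have v1 := recurrence 1
        have v2 := recurrence 2
        have v3 := recurrence 3
        have v4 := recurrence 4
        have v5 := recurrence 5
        have v6 := recurrence 6
        have t0 := tail 0
        have t1 := tail 1
        have t2 := tail 2
        have t3 := tail 3
        norm_num at v0 v1 v2 v3 v4 v5 v6 t0 t1 t2 t3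
        rw [step, if_neg (by omega)]
        interval_cases m <;> norm_num <;> linarith
      · have := ih (m - 15) (by omega)
        rw [step, if_pos h]
        rw [Nat.cast_sub h] at this
        rcases Nat.mod_two_eq_zero_or_one m with hm | hm
        · rw [if_pos hm]
          rw [if_neg (by omega)] at this
          have e := (tail ((m - 8) / 2)).2
          rw [show 2 * ((m - 8) / 2) + 8 = m by omega] at e
          push_cast at this
          linarith
        · rw [if_neg (by omega)]
          rw [if_pos (by omega)] at this
          have e := (tail ((m - 7) / 2)).1
          rw [show 2 * ((m - 7) / 2) + 7 = m by omega] at e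
          push_cast at this
          linarith
  have hb := bound m
  have : (if m % 2 = 0 then 1 / 2 else 0 : ℝ) ≤ 1 / 2 := by split_ifs <;> norm_num
  simp
  linarith

open PowerSeries in
theorem one_sub_X_ne_zero : (1 - X : PowerSeries ℝ) ≠ 0 := by
  intro h
  have := congrArg constantCoeff h
  simp at this

section Bounds

open PowerSeries

variable {a : ℕ → ℕ} {e : ℕ} {G : PowerSeries ℝ}

theorem coeff_le_of_mul_prod_eq_one (ha : ∀ i, 0 < a i) (h1 : a 0 = 1)
    (hG : G * ∏ i ∈ Finset.range (e + 3), (1 - X ^ a i) = 1) (m : ℕ) :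
    coeff m G ≤ 1 / (∏ i ∈ Finset.range (e + 3), (a i : ℝ)) / (e + 2).factorial *
      (m + ∑ i ∈ Finset.range (e + 3), (a i : ℝ)) ^ (e + 2) := by
  have hf : G * ∏ i ∈ Finset.Ico 1 (e + 3), (1 - X ^ a i) = PowerSeries.mk 1 := by
    refine mul_right_cancel₀ one_sub_X_ne_zero ?_
    rw [← Finset.prod_range_mul_prod_Ico _ (show 1 ≤ e + 3 by omega), Finset.prod_range_one,
      h1] at hG
    rw [mk_one_mul_one_sub_eq_one]
    linear_combination hG
  have h := coeff_le_of_mul_prod a ha (j := 0) (C := 1) (s := 0) zero_le_one le_rfl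
    (Finset.Ico 1 (e + 3)) G (by simp [hf]) m
  rw [Nat.card_Ico, show 0 + (e + 3 - 1) = e + 2 by omega, zero_add, mul_div_right_comm] at h
  rw [← Finset.prod_range_mul_prod_Ico _ (show 1 ≤ e + 3 by omega),
    ← Finset.sum_range_add_sum_Ico _ (show 1 ≤ e + 3 by omega)]
  simp only [Finset.prod_range_one, Finset.sum_range_one, h1, Nat.cast_one, one_mul]
  refine h.trans ?_
  gcongr
  linarith

theorem le_coeff_succ_sub_of_mul_prod_eq_one (ha : ∀ i, 0 < a i)
    (h1 : a 0 = 1) (h2 : a 1 = 2) (h3 : a 2 = 3)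
    (hG : G * ∏ i ∈ Finset.range (e + 3), (1 - X ^ a i) = 1) (m : ℕ) :
    1 / (∏ i ∈ Finset.range (e + 3), (a i : ℝ)) / (e + 1).factorial *
      (max ((m : ℝ) + 1 - 6) 0) ^ (e + 1) ≤ coeff (m + 1) G - coeff m G := by
  have hf : G * (1 - X ^ 1) * (∏ i ∈ Finset.Ico 3 (e + 3), (1 - X ^ a i))
      * ((1 - X ^ 2) * (1 - X ^ 3)) = 1 := by
    rw [← Finset.prod_range_mul_prod_Ico _ (show 3 ≤ e + 3 by omega)] at hG
    simp only [Finset.prod_range_succ, Finset.prod_range_zero, h1, h2, h3] at hG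
    linear_combination hG
  have h := le_coeff_of_mul_prod a ha (j := 1) (C := 1 / 6) (s := 6) (by norm_num) (by norm_num)
    (Finset.Ico 3 (e + 3)) _ (le_coeff_of_mul_two_three hf) (m + 1)
  rw [Nat.card_Ico, show 1 + (e + 3 - 3) = e + 1 by omega, mul_div_right_comm,
    coeff_mul_one_sub_X_pow, if_pos (by omega), Nat.add_sub_cancel] at h
  rw [← Finset.prod_range_mul_prod_Ico _ (show 3 ≤ e + 3 by omega)]
  simp only [Finset.prod_range_succ, Finset.prod_range_zero, h1, h2, h3]
  convert h using 3
  · rw [div_div]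
    norm_num
  · push_cast
    rfl

theorem coeff_second_difference_le_of_mul_prod_eq_one (ha : ∀ i, 0 < a i)
    (h1 : a 0 = 1) (h2 : a 1 = 2) (h3 : a 2 = 3) (h5 : a 4 = 5) (he : 3 ≤ e)
    (hG : G * ∏ i ∈ Finset.range (e + 3), (1 - X ^ a i) = 1) (m : ℕ) :
    coeff (m + 2) G - 2 * coeff (m + 1) G + coeff m G ≤
      1 / (∏ i ∈ Finset.range (e + 3), (a i : ℝ)) / e.factorial *
        (m + 2 + (40 + ∑ i ∈ Finset.range (e + 3), (a i : ℝ))) ^ e := by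
  have hmem : 4 ∈ Finset.Ico 3 (e + 3) := by
    rw [Finset.mem_Ico]
    omega
  have hf : G * (1 - X ^ 1) * (1 - X ^ 1) * (∏ i ∈ (Finset.Ico 3 (e + 3)).erase 4, (1 - X ^ a i))
      * ((1 + X) * ((1 - X ^ 3) * (1 - X ^ 5))) = 1 := by
    refine mul_right_cancel₀ one_sub_X_ne_zero ?_
    rw [← Finset.prod_range_mul_prod_Ico _ (show 3 ≤ e + 3 by omega),
      ← Finset.mul_prod_erase _ _ hmem] at hG
    simp only [Finset.prod_range_succ, Finset.prod_range_zero, h1, h2, h3, h5] at hG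
    linear_combination (1 - X) * hG
  have h := coeff_le_of_mul_prod a ha (j := 1) (C := 1 / 30) (s := 40) (by norm_num)
    (by norm_num) _ _ (coeff_le_of_mul_alternating_three_five hf) (m + 2)
  rw [Finset.card_erase_of_mem hmem, Nat.card_Ico, show 1 + (e + 3 - 3 - 1) = e by omega,
    mul_div_right_comm, coeff_mul_one_sub_X_pow, if_pos (by omega), coeff_mul_one_sub_X_pow,
    coeff_mul_one_sub_X_pow, if_pos (by omega), if_pos (by omega),
    show m + 2 - 1 = m + 1 by omega, Nat.add_sub_cancel] at h
  rw [← Finset.prod_range_mul_prod_Ico _ (show 3 ≤ e + 3 by omega),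
    ← Finset.sum_range_add_sum_Ico _ (show 3 ≤ e + 3 by omega),
    ← Finset.mul_prod_erase _ _ hmem, ← Finset.add_sum_erase _ _ hmem]
  simp only [Finset.prod_range_succ, Finset.prod_range_zero, Finset.sum_range_succ,
    Finset.sum_range_zero, h1, h2, h3, h5]
  refine le_trans (le_of_eq (by ring)) (h.trans ?_)
  rw [div_div (1 : ℝ) 30]
  push_cast
  rw [← mul_assoc, show (1 * 1 * 2 * 3 * 5 : ℝ) = 30 by norm_num]
  gcongr
  linarith

end Bounds

theorem one_add_pow_le_one_add {x η : ℝ} {l : ℕ} (hx : 0 ≤ x) (hη : η ≤ 1) (h : l * x ≤ η / 2)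
    (hx1 : x ≤ 1) : (1 + x) ^ l ≤ 1 + η := by
  have hb : 1 - l * x ≤ (1 - x) ^ l := by
    have := one_add_mul_le_pow (a := -x) (by linarith) l
    rw [← sub_eq_add_neg] at this
    linarith
  have hlx : 0 ≤ l * x := by positivity
  have hp : (1 + x) ^ l * (1 - x) ^ l ≤ 1 := by
    rw [← mul_pow]
    exact pow_le_one₀ (mul_nonneg (by linarith) (by linarith)) (by nlinarith)
  have hpos : 0 ≤ (1 + x) ^ l := by positivity
  have hη2 : (1 + x) ^ l * (1 - η / 2) ≤ 1 :=
    (mul_le_mul_of_nonneg_left (by linarith) hpos).trans hp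
  nlinarith

theorem one_add_inv_sq_mul_lt_sq {e : ℕ} (he : 3 ≤ e) {N T c u v w : ℝ} (hT : 6 ≤ T)
    (hN : 16 * ((e : ℝ) + 2) ^ 2 * T ≤ N) (hc : 0 < c) (hu : 0 ≤ u) (hv : 0 ≤ v)
    (huU : u ≤ c * (N + T) ^ (e + 2)) (hvU : v ≤ c * (N + T) ^ (e + 2))
    (hwU : w ≤ c * (N + T) ^ (e + 2))
    (hvu : c * (e + 2) * (N - 6) ^ (e + 1) ≤ v - u) (hwv : c * (e + 2) * (N - 6) ^ (e + 1) ≤ w - v)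
    (hδ : w - 2 * v + u ≤ c * (e + 2) * (e + 1) * (N + T) ^ e) :
    (1 + 1 / N ^ 2) * w * u < v ^ 2 := by
  have he' : (3 : ℝ) ≤ e := by exact_mod_cast he
  obtain ⟨d, hd⟩ : ∃ d : ℝ, d = e + 2 := ⟨_, rfl⟩
  have hd5 : 5 ≤ d := by linarith
  rw [← hd] at hN hvu hwv hδ
  rw [show (e : ℝ) + 1 = d - 1 by linarith] at hδ
  have hNT : T ≤ N := by
    have : 1 ≤ 16 * d ^ 2 := by nlinarith
    exact (le_mul_of_one_le_left (by linarith) this).trans hN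
  have hN0 : 0 < N := by linarith
  have hx0 : 0 ≤ T / N := by positivity
  have hx1 : T / N ≤ 1 := (div_le_one hN0).2 hNT
  have hdx : 16 * d ^ 2 * (T / N) ≤ 1 := by
    rw [mul_div_assoc', div_le_one hN0]
    exact hN
  have hη : 2 * d * (T / N) ≤ 1 / (4 * d) / 2 := by
    rw [div_div, le_div_iff₀ (by positivity)]
    linarith
  have hup : (1 + T / N) ^ (2 * e + 4) ≤ 1 + 1 / (4 * d) := by
    refine one_add_pow_le_one_add hx0 ?_ ?_ hx1
    · rw [div_le_one (by positivity)]
      linarith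
    · rw [show ((2 * e + 4 : ℕ) : ℝ) = 2 * d by rw [hd]; push_cast; ring]
      exact hη
  have hup' : (1 + T / N) ^ (2 * e + 2) ≤ 1 + 1 / (4 * d) :=
    (pow_le_pow_right₀ (by linarith) (by omega)).trans hup
  have hlow : 1 - 1 / (4 * d) ≤ (1 - 6 / N) ^ (2 * e + 2) := by
    have h6 : 6 / N ≤ T / N := by gcongr
    have h6' : 0 ≤ 6 / N := by positivity
    have := one_add_mul_le_pow (a := -(6 / N)) (by linarith) (2 * e + 2)
    rw [← sub_eq_add_neg] at this
    refine le_trans ?_ this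
    have h4 : 0 ≤ 1 / (4 * d) := by positivity
    push_cast
    nlinarith
  obtain ⟨M, hM⟩ : ∃ M, M = N ^ (2 * e + 2) := ⟨_, rfl⟩
  have hM0 : 0 < M := by rw [hM]; positivity
  have eA : (N - 6) ^ (e + 1) * (N - 6) ^ (e + 1) = M * (1 - 6 / N) ^ (2 * e + 2) := by
    rw [hM, ← pow_add, ← mul_pow, mul_sub, mul_one, mul_div_cancel₀ _ hN0.ne']
    congr 1
    ring
  have eNT : N + T = N * (1 + T / N) := by field_simp
  have eB : (N + T) ^ (e + 2) * (N + T) ^ e = M * (1 + T / N) ^ (2 * e + 2) := by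
    rw [hM, eNT]
    generalize 1 + T / N = y
    ring
  have eE : 1 / N ^ 2 * ((N + T) ^ (e + 2) * (N + T) ^ (e + 2))
      = M * (1 + T / N) ^ (2 * e + 4) := by
    rw [hM, eNT]
    generalize 1 + T / N = y
    field_simp
    ring
  have hA0 : 0 ≤ c * d * (N - 6) ^ (e + 1) := by
    have : 0 ≤ N - 6 := by linarith
    positivity
  have b1 : c ^ 2 * d ^ 2 * (M * (1 - 1 / (4 * d))) ≤ (w - v) * (v - u) := by
    refine le_trans ?_ (mul_le_mul hwv hvu hA0 (hA0.trans hwv))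
    rw [show c * d * (N - 6) ^ (e + 1) * (c * d * (N - 6) ^ (e + 1))
      = c ^ 2 * d ^ 2 * ((N - 6) ^ (e + 1) * (N - 6) ^ (e + 1)) by ring, eA]
    gcongr
  have b2 : v * (w - 2 * v + u) ≤ c ^ 2 * (d * (d - 1)) * (M * (1 + 1 / (4 * d))) := by
    have hd1 : 0 ≤ d - 1 := by linarith
    refine (mul_le_mul_of_nonneg_left hδ hv).trans
      ((mul_le_mul_of_nonneg_right hvU (by positivity)).trans ?_)
    rw [show c * (N + T) ^ (e + 2) * (c * d * (d - 1) * (N + T) ^ e)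
      = c ^ 2 * (d * (d - 1)) * ((N + T) ^ (e + 2) * (N + T) ^ e) by ring, eB]
    gcongr
  have b3 : 1 / N ^ 2 * (w * u) ≤ c ^ 2 * (M * (1 + 1 / (4 * d))) := by
    calc 1 / N ^ 2 * (w * u)
        ≤ 1 / N ^ 2 * (c * (N + T) ^ (e + 2) * (c * (N + T) ^ (e + 2))) := by gcongr
      _ = c ^ 2 * (1 / N ^ 2 * ((N + T) ^ (e + 2) * (N + T) ^ (e + 2))) := by ring
      _ ≤ _ := by
        rw [eE]
        gcongr
  have key : 0 < d ^ 2 * (1 - 1 / (4 * d)) - (d * (d - 1) + 1) * (1 + 1 / (4 * d)) := by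
    have : d ^ 2 * (1 - 1 / (4 * d)) - (d * (d - 1) + 1) * (1 + 1 / (4 * d))
        = (2 * d ^ 2 - 3 * d - 1) / (4 * d) := by
      field_simp
      ring
    rw [this]
    exact div_pos (by nlinarith) (by linarith)
  have := mul_pos (mul_pos (pow_pos hc 2) hM0) key
  nlinarith

theorem stmt11 (a : ℕ → ℕ) (hmono : StrictMono a)
    (h1 : a 0 = 1) (h2 : a 1 = 2) (h3 : a 2 = 3) (h4 : a 3 = 4) (h5 : a 4 = 5)
    (k : ℕ) (hk : 5 < k) :
    ∀ n : ℕ,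
      432 * (k : ℝ) ^ 2 * (Nat.factorial (k - 1) : ℝ) * (a (k - 1) : ℝ) ^ (k + 3) *
          Real.exp (1 / (a (k - 1) : ℝ)) < (n : ℝ) →
      (1 + 1 / (n : ℝ) ^ 2) * (pA a k ((n : ℤ) + 1) : ℝ) * (pA a k ((n : ℤ) - 1) : ℝ) <
          (pA a k (n : ℤ) : ℝ) ^ 2 ∧
        pA a k ((n : ℤ) + 1) * pA a k ((n : ℤ) - 1) < pA a k (n : ℤ) ^ 2 := by
  intro n hn
  have ha : ∀ i, 0 < a i := fun i => by
    have := hmono.monotone (Nat.zero_le i)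
    omega
  suffices h : (1 + 1 / (n : ℝ) ^ 2) * (pA a k ((n : ℤ) + 1) : ℝ) * (pA a k ((n : ℤ) - 1) : ℝ) <
      (pA a k (n : ℤ) : ℝ) ^ 2 by
    refine ⟨h, ?_⟩
    have hpos : 0 ≤ 1 / (n : ℝ) ^ 2 * ((pA a k ((n : ℤ) + 1) : ℝ) * (pA a k ((n : ℤ) - 1) : ℝ)) := by
      positivity
    have : (pA a k ((n : ℤ) + 1) : ℝ) * (pA a k ((n : ℤ) - 1) : ℝ) < (pA a k (n : ℤ) : ℝ) ^ 2 := by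
      linarith
    exact_mod_cast this
  obtain ⟨e, rfl⟩ : ∃ e, k = e + 3 := ⟨k - 3, by omega⟩
  have he : 3 ≤ e := by omega
  have hN : 432 * ((e : ℝ) + 3) ^ 2 * (a (e + 2) : ℝ) ^ 2 ≤ n := by
    refine le_trans ?_ hn.le
    have f1 : (1 : ℝ) ≤ (e + 2).factorial := by exact_mod_cast Nat.factorial_pos _
    have f2 : (1 : ℝ) ≤ Real.exp (1 / (a (e + 2) : ℝ)) := Real.one_le_exp (by positivity)
    have f3 : (a (e + 2) : ℝ) ^ 2 ≤ (a (e + 2) : ℝ) ^ (e + 3 + 3) :=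
      pow_le_pow_right₀ (by exact_mod_cast ha _) (by omega)
    push_cast
    calc 432 * ((e : ℝ) + 3) ^ 2 * (a (e + 2) : ℝ) ^ 2
        = 432 * ((e : ℝ) + 3) ^ 2 * 1 * (a (e + 2) : ℝ) ^ 2 * 1 := by ring
      _ ≤ _ := by gcongr
  have hak : (e : ℝ) + 3 ≤ a (e + 2) := by
    have key (i : ℕ) : i + 1 ≤ a i := by
      induction i with
      | zero => omega
      | succ i ih =>
        have := hmono (Nat.lt_succ_self i)
        simp only [Nat.succ_eq_add_one] at this
        omega
    exact_mod_cast key (e + 2)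
  have he' : (3 : ℝ) ≤ e := by exact_mod_cast he
  have hn6 : (6 : ℝ) ≤ n := by
    have : (1 : ℝ) * 1 ≤ ((e : ℝ) + 3) ^ 2 * (a (e + 2) : ℝ) ^ 2 :=
      mul_le_mul (by nlinarith) (by nlinarith) zero_le_one (by positivity)
    linarith
  have hS : ∑ i ∈ Finset.range (e + 3), (a i : ℝ) ≤ ((e : ℝ) + 3) * a (e + 2) := by
    have := Finset.sum_le_card_nsmul (Finset.range (e + 3)) (fun i => (a i : ℝ)) (a (e + 2) : ℝ)
      (fun i hi => by
        have := Finset.mem_range.1 hi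
        exact_mod_cast hmono.monotone (show i ≤ e + 2 by omega))
    simpa using this
  have hS0 : 0 ≤ ∑ i ∈ Finset.range (e + 3), (a i : ℝ) := by positivity
  have hG := mk_pA_mul_prod a ha (e + 3)
  have up := coeff_le_of_mul_prod_eq_one ha h1 hG
  have low := le_coeff_succ_sub_of_mul_prod_eq_one ha h1 h2 h3 hG
  have snd := coeff_second_difference_le_of_mul_prod_eq_one ha h1 h2 h3 h5 he hG
  simp only [PowerSeries.coeff_mk] at up low snd
  obtain ⟨m, rfl⟩ : ∃ m, n = m + 1 := by
    refine Nat.exists_eq_add_of_le' ?_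
    have : (1 : ℝ) ≤ n := by linarith
    exact_mod_cast this
  rw [show ((m + 1 : ℕ) : ℤ) + 1 = ((m + 2 : ℕ) : ℤ) by push_cast; ring,
    show ((m + 1 : ℕ) : ℤ) - 1 = (m : ℤ) by push_cast; ring]
  set S := ∑ i ∈ Finset.range (e + 3), (a i : ℝ)
  set P := ∏ i ∈ Finset.range (e + 3), (a i : ℝ)
  have hP : 0 < P := Finset.prod_pos fun i _ => by exact_mod_cast ha i
  have c1 : 1 / P / (e + 1).factorial = 1 / P / (e + 2).factorial * ((e : ℝ) + 2) := by
    rw [Nat.factorial_succ (e + 1)]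
    push_cast
    field_simp
    ring
  have c2 : 1 / P / e.factorial = 1 / P / (e + 2).factorial * ((e : ℝ) + 2) * (e + 1) := by
    rw [← c1, Nat.factorial_succ e]
    push_cast
    field_simp
  rw [c1] at low
  rw [c2] at snd
  have hc : 0 < 1 / P / (e + 2).factorial := by positivity
  set c := 1 / P / (e + 2).factorial
  refine one_add_inv_sq_mul_lt_sq he (T := 41 + S) (by linarith) ?_ hc (by positivity)
    (by positivity) ((up m).trans ?_) ((up (m + 1)).trans ?_) ((up (m + 2)).trans ?_)
    (le_trans ?_ (low m)) (le_trans ?_ (low (m + 1))) ((snd m).trans ?_)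
  · refine le_trans ?_ hN
    have hka : 36 ≤ ((e : ℝ) + 3) * a (e + 2) := by nlinarith
    have hkk : ((e : ℝ) + 3) * a (e + 2) ≤ (a (e + 2) : ℝ) ^ 2 := by nlinarith
    calc 16 * ((e : ℝ) + 2) ^ 2 * (41 + S)
        ≤ 16 * ((e : ℝ) + 3) ^ 2 * (3 * (a (e + 2) : ℝ) ^ 2) := by
          gcongr
          · norm_num
          · linarith
      _ ≤ _ := by nlinarith [mul_nonneg (sq_nonneg ((e : ℝ) + 3)) (sq_nonneg (a (e + 2) : ℝ))]
  all_goals push_cast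
  · gcongr ?_ * ?_ ^ _
    linarith
  · gcongr ?_ * ?_ ^ _
    linarith
  · gcongr ?_ * ?_ ^ _
    linarith
  · push_cast at hn6
    refine mul_le_mul_of_nonneg_left (pow_le_pow_left₀ (by linarith) ?_ _) (by positivity)
    exact le_max_left _ _
  · push_cast at hn6
    refine mul_le_mul_of_nonneg_left (pow_le_pow_left₀ (by linarith) ?_ _) (by positivity)
    exact le_trans (by linarith) (le_max_left _ _)
  · gcongr ?_ * ?_ ^ _
    linarith
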